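/- Let X be a metric space with its Borel σ-algebra, Z, M, V topological spaces with their Borel σ-algebras, and p_x a Borel probability measure on X (the real image distribution). Let G : Z → M be continuous (the generator), μ_z a Borel probability measure on Z, and set p_m := μ_z.map G. Let Ω_v ⊆ V, and let R : M × V → X be continuous (the rendering engine) and injective on (support of p_m) × Ω_v. Let E_z : X → Z and E_v : X → V be continuous (the encoder) with E_z(x) ∈ support of μ_z and E_v(x) ∈ Ω_v for every x ∈ X. If the integral over x with respect to p_x of dist(x, R(G(E_z(x)), E_v(x)))² equals zero, then for every x_r in the support of p_x such that x_r = R(m_r, v_r) for some m_r in the support of p_m and v_r ∈ Ω_v, one has G(E_z(x_r)) = m_r and E_v(x_r) = v_r. -/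

import Mathlib

open MeasureTheory

/-- The support of a Borel measure: the set of points every open neighborhood of which has
positive measure. -/
def measureSupport {α : Type*} [TopologicalSpace α] [MeasurableSpace α]
    (μ : Measure α) : Set α :=
  {x | ∀ U : Set α, IsOpen U → x ∈ U → 0 < μ U}

/-- A continuous map sends the support of a measure into the support of its pushforward. -/
theorem measureSupport_mapsTo_map {α β : Type*}
    [TopologicalSpace α] [MeasurableSpace α] [OpensMeasurableSpace α]
    [TopologicalSpace β] [MeasurableSpace β] [BorelSpace β]
    {μ : Measure α} {f : α → β} (hf : Continuous f) :
    Set.MapsTo f (measureSupport μ) (measureSupport (μ.map f)) := by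
  intro x hx U hU hxU
  rw [Measure.map_apply hf.measurable hU.measurableSet]
  exact hx _ (hU.preimage hf) hxU

/-- A continuous function with values in `ℝ≥0∞` and zero integral vanishes on the support of the
measure. -/
theorem eq_zero_of_mem_measureSupport_of_lintegral_eq_zero {α : Type*}
    [TopologicalSpace α] [MeasurableSpace α] [OpensMeasurableSpace α]
    {μ : Measure α} {f : α → ENNReal} (hf : Continuous f) (h : ∫⁻ x, f x ∂μ = 0)
    {x : α} (hx : x ∈ measureSupport μ) : f x = 0 := by
  by_contra hne
  have hpos := hx {y | f y ≠ 0} (isOpen_ne_fun hf continuous_const) hne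
  exact hpos.ne' ((lintegral_eq_zero_iff hf.measurable).1 h)

/-- Theorem 3 of the paper: when the autoencoder loss vanishes, the encoder recovers the
correct scene representation and viewpoint for every real image in the support of the data
distribution. -/
theorem encoder_recovers_scene_and_viewpoint
    {X Z M V : Type*}
    [MetricSpace X] [MeasurableSpace X] [BorelSpace X]
    [TopologicalSpace Z] [MeasurableSpace Z] [BorelSpace Z]
    [TopologicalSpace M] [MeasurableSpace M] [BorelSpace M]
    [TopologicalSpace V] [MeasurableSpace V] [BorelSpace V]
    (p_x : Measure X) [IsProbabilityMeasure p_x]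
    (G : Z → M) (hG : Continuous G)
    (μ_z : Measure Z) [IsProbabilityMeasure μ_z]
    (p_m : Measure M) (hp_m : p_m = μ_z.map G)
    (Ω_v : Set V) (R : M × V → X) (hR : Continuous R)
    (hR_inj : Set.InjOn R ((measureSupport p_m) ×ˢ Ω_v))
    (E_z : X → Z) (E_v : X → V) (hE_z : Continuous E_z) (hE_v : Continuous E_v)
    (hE_z_mem : ∀ x, E_z x ∈ measureSupport μ_z)
    (hE_v_mem : ∀ x, E_v x ∈ Ω_v)
    (h_ae : ∫⁻ x, ENNReal.ofReal (dist x (R (G (E_z x), E_v x)) ^ 2) ∂p_x = 0) :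
    ∀ x_r ∈ measureSupport p_x, ∀ m_r ∈ measureSupport p_m, ∀ v_r ∈ Ω_v,
      x_r = R (m_r, v_r) → G (E_z x_r) = m_r ∧ E_v x_r = v_r := by
  intro x_r hx m_r hm v_r hv h_eq
  have h_cont :
      Continuous fun x => ENNReal.ofReal (dist x (R (G (E_z x), E_v x)) ^ 2) := by
    exact ENNReal.continuous_ofReal.comp (by fun_prop)
  have h_zero := eq_zero_of_mem_measureSupport_of_lintegral_eq_zero h_cont h_ae hx
  have h_dist : dist x_r (R (G (E_z x_r), E_v x_r)) = 0 :=
    pow_eq_zero_iff two_ne_zero |>.1 ((ENNReal.ofReal_eq_zero.1 h_zero).antisymm (sq_nonneg _))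
  have h_rec : R (G (E_z x_r), E_v x_r) = R (m_r, v_r) :=
    (dist_eq_zero.1 h_dist).symm.trans h_eq
  have hG_mem : G (E_z x_r) ∈ measureSupport p_m :=
    hp_m ▸ measureSupport_mapsTo_map hG (hE_z_mem x_r)
  exact Prod.mk.inj (hR_inj ⟨hG_mem, hE_v_mem x_r⟩ ⟨hm, hv⟩ h_rec)
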